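/- Let q, r : ℝ² → ℂ be infinitely differentiable functions of (x, t) satisfying the second AKNS (NLS-type) system q_t = q_{xx} − 2q²r and r_t = −r_{xx} + 2q r² at every point. Then the third conservation law holds at every point: ∂_t(q r_{xx} − q²r²) = ∂_x(q_x r_{xx} − q r_{xxx} + 4q²r r_x). -/

import Mathlib

/-- Partial derivative in the first (spatial) variable `x`. -/
noncomputable def pdx (f : ℝ → ℝ → ℂ) : ℝ → ℝ → ℂ := fun x t => deriv (fun x' => f x' t) x

/-- Partial derivative in the second (temporal) variable `t`. -/
noncomputable def pdt (f : ℝ → ℝ → ℂ) : ℝ → ℝ → ℂ := fun x t => deriv (fun t' => f x t') t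

section PartialDerivatives

variable {f : ℝ → ℝ → ℂ}

theorem hasDerivAt_pdx (hf : ContDiff ℝ (⊤ : ℕ∞) fun p : ℝ × ℝ => f p.1 p.2) (x t : ℝ) :
    HasDerivAt (fun x' => f x' t) (pdx f x t) x := by
  have h : ContDiff ℝ (⊤ : ℕ∞) fun x' => f x' t :=
    hf.comp (contDiff_id.prodMk contDiff_const)
  exact (h.differentiable (by simp) x).hasDerivAt

theorem hasDerivAt_pdt (hf : ContDiff ℝ (⊤ : ℕ∞) fun p : ℝ × ℝ => f p.1 p.2) (x t : ℝ) :
    HasDerivAt (fun t' => f x t') (pdt f x t) t := by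
  have h : ContDiff ℝ (⊤ : ℕ∞) fun t' => f x t' :=
    hf.comp (contDiff_const.prodMk contDiff_id)
  exact (h.differentiable (by simp) t).hasDerivAt

theorem pdx_eq_fderiv (hf : ContDiff ℝ (⊤ : ℕ∞) fun p : ℝ × ℝ => f p.1 p.2) (x t : ℝ) :
    pdx f x t = fderiv ℝ (fun p : ℝ × ℝ => f p.1 p.2) (x, t) (1, 0) :=
  (HasFDerivAt.comp_hasDerivAt (f := fun x' => (x', t)) x
    (hf.differentiable (by simp) (x, t)).hasFDerivAt
    ((hasDerivAt_id x).prodMk (hasDerivAt_const x t))).deriv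

theorem pdt_eq_fderiv (hf : ContDiff ℝ (⊤ : ℕ∞) fun p : ℝ × ℝ => f p.1 p.2) (x t : ℝ) :
    pdt f x t = fderiv ℝ (fun p : ℝ × ℝ => f p.1 p.2) (x, t) (0, 1) :=
  (HasFDerivAt.comp_hasDerivAt (f := fun t' => (x, t')) t
    (hf.differentiable (by simp) (x, t)).hasFDerivAt
    ((hasDerivAt_const t x).prodMk (hasDerivAt_id t))).deriv

theorem contDiff_pdx (hf : ContDiff ℝ (⊤ : ℕ∞) fun p : ℝ × ℝ => f p.1 p.2) :
    ContDiff ℝ (⊤ : ℕ∞) fun p : ℝ × ℝ => pdx f p.1 p.2 := by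
  simp only [pdx_eq_fderiv hf]
  exact (hf.fderiv_right (m := (⊤ : ℕ∞)) (by simp)).clm_apply contDiff_const

theorem contDiff_pdt (hf : ContDiff ℝ (⊤ : ℕ∞) fun p : ℝ × ℝ => f p.1 p.2) :
    ContDiff ℝ (⊤ : ℕ∞) fun p : ℝ × ℝ => pdt f p.1 p.2 := by
  simp only [pdt_eq_fderiv hf]
  exact (hf.fderiv_right (m := (⊤ : ℕ∞)) (by simp)).clm_apply contDiff_const

theorem pdt_pdx_comm (hf : ContDiff ℝ (⊤ : ℕ∞) fun p : ℝ × ℝ => f p.1 p.2) :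
    pdt (pdx f) = pdx (pdt f) := by
  funext x t
  have hd : DifferentiableAt ℝ (fderiv ℝ fun p : ℝ × ℝ => f p.1 p.2) (x, t) :=
    (hf.fderiv_right (m := (⊤ : ℕ∞)) (by simp)).differentiable (by simp) _
  have hs : IsSymmSndFDerivAt ℝ (fun p : ℝ × ℝ => f p.1 p.2) (x, t) :=
    hf.contDiffAt.isSymmSndFDerivAt (by
      rw [minSmoothness_of_isRCLikeNormedField]
      exact WithTop.coe_le_coe.2 le_top)
  rw [pdt_eq_fderiv (contDiff_pdx hf), pdx_eq_fderiv (contDiff_pdt hf)]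
  simp only [pdx_eq_fderiv hf, pdt_eq_fderiv hf]
  rw [fderiv_clm_apply hd (by fun_prop), fderiv_clm_apply hd (by fun_prop)]
  simpa using hs.eq (0, 1) (1, 0)

end PartialDerivatives

/-- If smooth `q, r` satisfy the second AKNS (NLS-type) system `q_t = q_{xx} − 2q²r`,
`r_t = −r_{xx} + 2qr²` everywhere, then the third conservation law
`∂_t(q r_{xx} − q²r²) = ∂_x(q_x r_{xx} − q r_{xxx} + 4q²r r_x)` holds everywhere. -/
theorem AKNS2_third_conservation_law (q r : ℝ → ℝ → ℂ)
    (hq : ContDiff ℝ (⊤ : ℕ∞) fun p : ℝ × ℝ => q p.1 p.2)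
    (hr : ContDiff ℝ (⊤ : ℕ∞) fun p : ℝ × ℝ => r p.1 p.2)
    (heq : ∀ x t : ℝ, pdt q x t = pdx (pdx q) x t - 2 * q x t ^ 2 * r x t)
    (her : ∀ x t : ℝ, pdt r x t = -(pdx (pdx r) x t) + 2 * q x t * r x t ^ 2) :
    ∀ x t : ℝ,
      pdt (fun x t => q x t * pdx (pdx r) x t - q x t ^ 2 * r x t ^ 2) x t =
        pdx (fun x t =>
          pdx q x t * pdx (pdx r) x t - q x t * pdx (pdx (pdx r)) x t
            + 4 * q x t ^ 2 * r x t * pdx r x t) x t := by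
  intro x t
  have hq1 := contDiff_pdx hq
  have hr1 := contDiff_pdx hr
  have hr2 := contDiff_pdx hr1
  have hr3 := contDiff_pdx hr2
  have dq := fun x => hasDerivAt_pdx hq x t
  have dq1 := fun x => hasDerivAt_pdx hq1 x t
  have dr := fun x => hasDerivAt_pdx hr x t
  have dr1 := fun x => hasDerivAt_pdx hr1 x t
  have dr2 := fun x => hasDerivAt_pdx hr2 x t
  have dr3 := fun x => hasDerivAt_pdx hr3 x t
  have hrt1 : ∀ y, pdx (pdt r) y t = -(pdx (pdx (pdx r)) y t)
      + (2 * pdx q y t * r y t ^ 2 + 4 * q y t * r y t * pdx r y t) := fun y => by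
    have h := (dr2 y).fun_neg.fun_add (((dq y).const_mul 2).fun_mul ((dr y).fun_pow 2))
    simp only [← her] at h
    refine h.deriv.trans ?_
    push_cast
    ring
  have hrt2 : pdt (pdx (pdx r)) x t = -(pdx (pdx (pdx (pdx r))) x t)
      + (2 * pdx (pdx q) x t * r x t ^ 2 + 8 * pdx q x t * r x t * pdx r x t
        + 4 * q x t * pdx r x t ^ 2 + 4 * q x t * r x t * pdx (pdx r) x t) := by
    rw [pdt_pdx_comm hr1, pdt_pdx_comm hr]
    have h := (dr3 x).fun_neg.fun_add
      ((((dq1 x).const_mul 2).fun_mul ((dr x).fun_pow 2)).fun_add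
        ((((dq x).const_mul 4).fun_mul (dr x)).fun_mul (dr1 x)))
    simp only [← hrt1] at h
    refine h.deriv.trans ?_
    push_cast
    ring
  have hL := ((hasDerivAt_pdt hq x t).fun_mul (hasDerivAt_pdt hr2 x t)).fun_sub
    (((hasDerivAt_pdt hq x t).fun_pow 2).fun_mul ((hasDerivAt_pdt hr x t).fun_pow 2))
  have hR := (((dq1 x).fun_mul (dr2 x)).fun_sub ((dq x).fun_mul (dr3 x))).fun_add
    (((((dq x).fun_pow 2).const_mul 4).fun_mul (dr x)).fun_mul (dr1 x))
  refine hL.deriv.trans (Eq.trans ?_ hR.deriv.symm)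
  rw [hrt2, heq, her]
  push_cast
  ring
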